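/- arXiv:2012.10015 — 2 statements merged into one kernel-verified Lean document; each statement's English description precedes it below -/
import Mathlib

section
/- Let n be a positive integer and ω an integer coprime to n, and set g = gcd(ω − 1, n). Then G(n,ω) has at least g-fold dihedral symmetry: G(n,ω) is invariant under complex conjugation and under multiplication by exp(2πi/g), i.e., G(n,ω) is invariant under the action of the dihedral group of order 2g on the complex plane. -/
/-- The Gaussian period `η_{n,ω,k} = Σ_{j=0}^{d-1} exp(2πi ω^j k / n)` where
`d = ord_n(ω)` is the multiplicative order of `ω` modulo `n`. -/
noncomputable def gaussianPeriod (n : ℕ) (ω k : ℤ) : ℂ :=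
  ∑ j ∈ Finset.range (orderOf ((ω : ZMod n))),
    Complex.exp (2 * Real.pi * Complex.I * ((ω ^ j * k : ℤ) : ℂ) / (n : ℂ))

/-- The set `G(n,ω) = {η_{n,ω,k} : k = 1, …, n} ⊆ ℂ`. -/
noncomputable def gaussSet (n : ℕ) (ω : ℤ) : Set ℂ :=
  (fun k : ℤ => gaussianPeriod n ω k) '' (Set.Icc 1 (n : ℤ))

theorem exp_int_div_eq_of_modEq {n : ℕ} (hn : 0 < n) {a b : ℤ} (h : a ≡ b [ZMOD n]) :
    Complex.exp (2 * Real.pi * Complex.I * (a : ℂ) / (n : ℂ)) =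
      Complex.exp (2 * Real.pi * Complex.I * (b : ℂ) / (n : ℂ)) := by
  obtain ⟨c, hc⟩ := h.symm.dvd
  have hn' : (n : ℂ) ≠ 0 := by exact_mod_cast hn.ne'
  refine Complex.exp_eq_exp_iff_exists_int.2 ⟨c, ?_⟩
  have ha : (a : ℂ) = b + n * c := by
    rw [sub_eq_iff_eq_add'.1 hc]
    push_cast
    ring
  rw [ha]
  field_simp

theorem gaussianPeriod_eq_of_modEq {n : ℕ} (hn : 0 < n) (ω : ℤ) {k l : ℤ}
    (h : k ≡ l [ZMOD n]) : gaussianPeriod n ω k = gaussianPeriod n ω l :=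
  Finset.sum_congr rfl fun j _ => exp_int_div_eq_of_modEq hn (h.mul_left (ω ^ j))

theorem gaussianPeriod_mem_gaussSet {n : ℕ} (hn : 0 < n) (ω k : ℤ) :
    gaussianPeriod n ω k ∈ gaussSet n ω := by
  have hn' : (0 : ℤ) < n := by exact_mod_cast hn
  have h0 := Int.emod_nonneg (k - 1) hn'.ne'
  have h1 := Int.emod_lt_of_pos (k - 1) hn'
  refine ⟨(k - 1) % n + 1, ⟨by lia, by lia⟩, gaussianPeriod_eq_of_modEq hn ω ?_⟩
  simpa using (Int.mod_modEq (k - 1) n).add_right 1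

theorem conj_gaussianPeriod (n : ℕ) (ω k : ℤ) :
    starRingEnd ℂ (gaussianPeriod n ω k) = gaussianPeriod n ω (-k) := by
  unfold gaussianPeriod
  rw [map_sum]
  refine Finset.sum_congr rfl fun j _ => ?_
  rw [← Complex.exp_conj]
  congr 1
  simp [Complex.conj_ofNat]

theorem exp_mul_gaussianPeriod {n : ℕ} (hn : 0 < n) {ω : ℤ} {g m : ℕ} (hgm : n = g * m)
    (hg : (g : ℤ) ∣ ω - 1) (k : ℤ) :
    Complex.exp (2 * Real.pi * Complex.I / (g : ℂ)) * gaussianPeriod n ω k =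
      gaussianPeriod n ω (k + m) := by
  unfold gaussianPeriod
  rw [Finset.mul_sum]
  refine Finset.sum_congr rfl fun j _ => ?_
  have hmod : m + ω ^ j * k ≡ ω ^ j * (k + m) [ZMOD n] := by
    refine Int.modEq_iff_dvd.2 ?_
    have h : (g : ℤ) ∣ ω ^ j - 1 := hg.trans (sub_one_dvd_pow_sub_one ω j)
    have h' := mul_dvd_mul_right h (m : ℤ)
    rw [hgm, show ω ^ j * (k + m) - (m + ω ^ j * k) = (ω ^ j - 1) * m by ring]
    exact_mod_cast h'
  rw [← exp_int_div_eq_of_modEq hn hmod, ← Complex.exp_add]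
  have hg0 : (g : ℂ) ≠ 0 := by
    rintro h
    simp_all
  have hm0 : (m : ℂ) ≠ 0 := by
    rintro h
    simp_all
  congr 1
  rw [hgm]
  push_cast
  field_simp

/-- With `g = gcd(ω-1, n)`, the set `G(n,ω)` has at least `g`-fold dihedral symmetry:
it is invariant under complex conjugation and under multiplication by `exp(2πi/g)`. -/
theorem gaussSet_dihedral_symmetry (n : ℕ) (hn : 0 < n) (ω : ℤ)
    (hω : Int.gcd ω n = 1) (g : ℕ) (hg : g = Int.gcd (ω - 1) (n : ℤ)) :
    (∀ z ∈ gaussSet n ω, starRingEnd ℂ z ∈ gaussSet n ω) ∧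
      ∀ z ∈ gaussSet n ω,
        Complex.exp (2 * Real.pi * Complex.I / (g : ℂ)) * z ∈ gaussSet n ω := by
  constructor
  · rintro _ ⟨k, -, rfl⟩
    rw [conj_gaussianPeriod]
    exact gaussianPeriod_mem_gaussSet hn ω (-k)
  · rintro _ ⟨k, -, rfl⟩
    obtain ⟨m, hm⟩ : g ∣ n := by
      rw [hg]
      exact Int.natCast_dvd_natCast.1 (Int.gcd_dvd_right _ _)
    have hgω : (g : ℤ) ∣ ω - 1 := hg ▸ Int.gcd_dvd_left _ _
    rw [exp_mul_gaussianPeriod hn hm hgω]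
    exact gaussianPeriod_mem_gaussSet hn ω (k + m)
end

section
/- Let n be a positive integer, ω an integer coprime to n, and c a positive divisor of n with c < n. Then the plot of G(n,ω) contains a rescaled copy of G(n/c, ω): specifically, { (ord_n(ω)/ord_{n/c}(ω)) · z : z ∈ G(n/c, ω) } ⊆ G(n, ω), where ord_m(ω) denotes the multiplicative order of ω modulo m. -/
/-- The sum of a `d`-periodic function over `q` full periods is `q` times the sum over one. -/
theorem Function.Periodic.sum_range_mul {M : Type*} [Semiring M] {f : ℕ → M} {d : ℕ}
    (hf : Function.Periodic f d) (q : ℕ) :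
    ∑ j ∈ Finset.range (q * d), f j = q * ∑ j ∈ Finset.range d, f j := by
  induction q with
  | zero => simp
  | succ q ih =>
    rw [Nat.succ_mul, Finset.sum_range_add, ih, Nat.cast_succ, add_mul, one_mul]
    congr 1
    refine Finset.sum_congr rfl fun j _ => ?_
    rw [add_comm]
    simpa using hf.nsmul q j

theorem Complex.exp_two_pi_I_mul_div_eq_of_dvd_sub {m : ℕ} (hm : m ≠ 0) {a b : ℤ}
    (h : (m : ℤ) ∣ a - b) :
    Complex.exp (2 * Real.pi * Complex.I * (a : ℂ) / (m : ℂ)) =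
      Complex.exp (2 * Real.pi * Complex.I * (b : ℂ) / (m : ℂ)) := by
  obtain ⟨t, ht⟩ := h
  have hm' : (m : ℂ) ≠ 0 := Nat.cast_ne_zero.mpr hm
  obtain rfl : a = b + m * t := by linarith
  refine Complex.exp_eq_exp_iff_exists_int.mpr ⟨t, ?_⟩
  push_cast
  field_simp

theorem periodic_exp_two_pi_I_pow_mul_div {m : ℕ} (hm : m ≠ 0) (ω k : ℤ) :
    Function.Periodic
      (fun j : ℕ => Complex.exp (2 * Real.pi * Complex.I * ((ω ^ j * k : ℤ) : ℂ) / (m : ℂ)))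
      (orderOf (ω : ZMod m)) := by
  intro j
  refine Complex.exp_two_pi_I_mul_div_eq_of_dvd_sub hm ?_
  rw [← ZMod.intCast_eq_intCast_iff_dvd_sub]
  simp [pow_add, pow_orderOf_eq_one]

/-- Multiplying the index and the modulus by `c` scales a Gaussian period by the ratio of the
multiplicative orders. -/
theorem gaussianPeriod_mul_left {c m : ℕ} (hc : c ≠ 0) (hm : m ≠ 0) (ω k : ℤ) :
    gaussianPeriod (c * m) ω (c * k) =
      ((orderOf (ω : ZMod (c * m)) / orderOf (ω : ZMod m) : ℕ) : ℂ) * gaussianPeriod m ω k := by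
  have hdvd : orderOf (ω : ZMod m) ∣ orderOf (ω : ZMod (c * m)) := by
    simpa using orderOf_map_dvd
      (ZMod.castHom (Dvd.intro_left c rfl) (ZMod m)).toMonoidHom (ω : ZMod (c * m))
  have hc' : (c : ℂ) ≠ 0 := Nat.cast_ne_zero.mpr hc
  have hm' : (m : ℂ) ≠ 0 := Nat.cast_ne_zero.mpr hm
  unfold gaussianPeriod
  rw [← (periodic_exp_two_pi_I_pow_mul_div hm ω k).sum_range_mul, Nat.div_mul_cancel hdvd]
  refine Finset.sum_congr rfl fun j _ => ?_
  congr 1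
  push_cast
  field_simp


/-- For `c` a positive divisor of `n` with `c < n`, the plot of `G(n,ω)` contains a copy
of `G(n/c,ω)` rescaled by the factor `ord_n(ω)/ord_{n/c}(ω)`. -/
theorem gaussSet_contains_rescaled (n : ℕ) (hn : 0 < n) (ω : ℤ)
    (hω : Int.gcd ω n = 1) (c : ℕ) (hc : 0 < c) (hcn : c ∣ n) (hlt : c < n) :
    ∀ z ∈ gaussSet (n / c) ω,
      ((orderOf ((ω : ZMod n)) / orderOf ((ω : ZMod (n / c))) : ℕ) : ℂ) * z ∈
        gaussSet n ω := by
  obtain ⟨m, rfl⟩ := hcn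
  have hm : m ≠ 0 := by rintro rfl; simp at hn
  rw [Nat.mul_div_cancel_left m hc]
  rintro z ⟨k, ⟨hk1, hkm⟩, rfl⟩
  have hc1 : (1 : ℤ) ≤ c := by exact_mod_cast hc
  refine ⟨c * k, ⟨by nlinarith, ?_⟩, gaussianPeriod_mul_left hc.ne' hm ω k⟩
  push_cast
  gcongr
end
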